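/- Let J ⊊ I be square-free monomial ideals of S = K[x_1,...,x_n] with I generated in degrees ≥ d and J in degrees ≥ d+1. If depth_S(I/J) ≥ d+2 then ρ_d(I) ≤ ρ_{d+1}(I\J) ≤ ρ_d(I) + ρ_{d+2}(I\J). -/

import Mathlib

open MvPolynomial

/-- A squarefree exponent vector. -/
def IsSqfree {n : ℕ} (m : Fin n →₀ ℕ) : Prop := ∀ j, m j ≤ 1

/-- Total degree of an exponent vector. -/
def mdeg {n : ℕ} (m : Fin n →₀ ℕ) : ℕ := m.sum fun _ e => e

/-- `I` is generated by squarefree monomials of degree `≥ d`. -/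
def GenSqfreeGe (K : Type*) [Field K] {n : ℕ} (d : ℕ)
    (I : Ideal (MvPolynomial (Fin n) K)) : Prop :=
  ∃ G : Set (Fin n →₀ ℕ), (∀ m ∈ G, IsSqfree m ∧ d ≤ mdeg m) ∧
    I = Ideal.span ((fun m => monomial m (1 : K)) '' G)

/-- `ρ_t(I \ J)`: the number of squarefree monomials of degree `t` in `I \ J`. -/
noncomputable def rho (K : Type*) [Field K] {n : ℕ}
    (I J : Ideal (MvPolynomial (Fin n) K)) (t : ℕ) : ℕ :=
  Set.ncard {m : Fin n →₀ ℕ | IsSqfree m ∧ mdeg m = t ∧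
    monomial m (1 : K) ∈ I ∧ monomial m (1 : K) ∉ J}

/-- The `S`-module `I/J`. -/
abbrev quotMod {K : Type*} [Field K] {n : ℕ}
    (I J : Ideal (MvPolynomial (Fin n) K)) :=
  I ⧸ (Submodule.comap I.subtype (J : Submodule (MvPolynomial (Fin n) K) (MvPolynomial (Fin n) K)))

/-- Depth of a module over `K[x_1,…,x_n]` w.r.t. the maximal graded ideal
`(x_1,…,x_n)`: the supremum of lengths of regular sequences on `M` from it. -/
noncomputable def mdepth (K : Type*) [Field K] (n : ℕ)
    (M : Type*) [AddCommGroup M] [Module (MvPolynomial (Fin n) K) M] : ℕ :=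
  sSup {k | ∃ rs : List (MvPolynomial (Fin n) K), rs.length = k ∧
    (∀ r ∈ rs, r ∈ Ideal.span (Set.range (X : Fin n → MvPolynomial (Fin n) K))) ∧
    RingTheory.Sequence.IsRegular M rs}

section Koszul

variable {ι R M N : Type*} [LinearOrder ι] [CommRing R] [AddCommGroup M] [Module R M]
  [AddCommGroup N] [Module R N]

/-- The sign `(-1) ^ #{l ∈ F | l < j}`. -/
def koszulSign (j : ι) (F : Finset ι) : ℤ := ∏ l ∈ F, if l < j then -1 else 1

/-- The differential of the Koszul cochain complex of `x` with coefficients in `M`, all degrees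
taken together: the component in degree `i` consists of functions supported on sets of size `i`. -/
def koszulD (x : ι → R) : (Finset ι → M) →ₗ[R] (Finset ι → M) where
  toFun f F := ∑ j ∈ F, koszulSign j F • x j • f (F.erase j)
  map_add' f g := by
    ext F
    simp [smul_add, Finset.sum_add_distrib]
  map_smul' a f := by
    ext F
    simp only [Pi.smul_apply, RingHom.id_apply, Finset.smul_sum]
    refine Finset.sum_congr rfl fun j _ => ?_
    rw [smul_comm (x j) a, smul_comm a (koszulSign j F)]

/-- Contraction with the `j`-th basis vector on the Koszul cochain complex. -/
def koszulContract (j : ι) (f : Finset ι → M) : Finset ι → M :=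
  fun F => if j ∈ F then 0 else koszulSign j F • f (insert j F)

lemma koszulD_apply (x : ι → R) (f : Finset ι → M) (F : Finset ι) :
    koszulD x f F = ∑ j ∈ F, koszulSign j F • x j • f (F.erase j) := rfl

lemma koszulD_comp (x : ι → R) (g : M →ₗ[R] N) (f : Finset ι → M) (F : Finset ι) :
    koszulD x (fun G => g (f G)) F = g (koszulD x f F) := by
  simp [koszulD_apply, map_sum]

lemma koszulSign_mul_self (j : ι) (F : Finset ι) : koszulSign j F * koszulSign j F = 1 := by
  rw [koszulSign, ← Finset.prod_mul_distrib]
  refine Finset.prod_eq_one fun l _ => ?_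
  split_ifs <;> norm_num

lemma koszulSign_insert {j l : ι} {F : Finset ι} (hj : j ∉ F) :
    koszulSign l (insert j F) = (if j < l then -1 else 1) * koszulSign l F := by
  rw [koszulSign, Finset.prod_insert hj, koszulSign]

lemma koszulSign_insert_self {j : ι} {F : Finset ι} (hj : j ∉ F) :
    koszulSign j (insert j F) = koszulSign j F := by
  simp [koszulSign_insert hj]

lemma koszulSign_anticomm {j l : ι} {F : Finset ι} (hj : j ∉ F) (hl : l ∈ F) :
    koszulSign j F * koszulSign l (insert j F) =
      -(koszulSign l F * koszulSign j (F.erase l)) := by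
  have hF : koszulSign j F = (if l < j then -1 else 1) * koszulSign j (F.erase l) := by
    rw [← koszulSign_insert (Finset.notMem_erase l F), Finset.insert_erase hl]
  have hne : j ≠ l := fun h => hj (h ▸ hl)
  rw [koszulSign_insert hj, hF]
  rcases lt_or_gt_of_ne hne with h | h
  · simp [h, h.not_gt, mul_comm]
  · simp [h, h.not_gt, mul_comm]

lemma koszulSign_erase_self (j : ι) (F : Finset ι) :
    koszulSign j (F.erase j) = koszulSign j F := by
  by_cases hj : j ∈ F
  · rw [← koszulSign_insert_self (Finset.notMem_erase j F), Finset.insert_erase hj]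
  · rw [Finset.erase_eq_of_notMem hj]

lemma koszulSign_erase_anticomm {j l : ι} {F : Finset ι} (hj : j ∈ F) (hl : l ∈ F.erase j) :
    koszulSign j F * koszulSign l (F.erase j) + koszulSign l F * koszulSign j (F.erase l) = 0 := by
  have h := koszulSign_anticomm (Finset.notMem_erase j F) hl
  rw [Finset.insert_erase hj, koszulSign_erase_self, Finset.erase_right_comm,
    koszulSign_erase_self] at h
  have h₁ := koszulSign_mul_self l F
  have h₂ := koszulSign_mul_self l (F.erase j)
  linear_combination koszulSign l F * koszulSign l (F.erase j) * h -
    koszulSign j F * koszulSign l (F.erase j) * h₁ -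
    koszulSign l F * koszulSign j (F.erase l) * h₂

lemma koszulD_koszulD (x : ι → R) (f : Finset ι → M) : koszulD x (koszulD x f) = 0 := by
  ext F
  simp only [koszulD_apply, Finset.smul_sum, Pi.zero_apply]
  rw [Finset.sum_sigma']
  refine Finset.sum_involution (fun p _ => ⟨p.2, p.1⟩) ?_ ?_ ?_ ?_
  · rintro ⟨j, l⟩ hp
    obtain ⟨hj, hl⟩ := Finset.mem_sigma.1 hp
    dsimp only at hj hl ⊢
    rw [smul_comm (x j) (koszulSign l (F.erase j)), smul_comm (x l) (koszulSign j (F.erase l)),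
      smul_smul, smul_smul (koszulSign l F), smul_comm (x l) (x j), Finset.erase_right_comm,
      ← add_smul, koszulSign_erase_anticomm hj hl, zero_smul]
  · rintro ⟨j, l⟩ hp _ h
    obtain ⟨-, hl⟩ := Finset.mem_sigma.1 hp
    exact Finset.ne_of_mem_erase hl (congrArg Sigma.fst h)
  · rintro ⟨j, l⟩ hp
    obtain ⟨hj, hl⟩ := Finset.mem_sigma.1 hp
    exact Finset.mem_sigma.2 ⟨Finset.mem_of_mem_erase hl,
      Finset.mem_erase.2 ⟨(Finset.ne_of_mem_erase hl).symm, hj⟩⟩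
  · rintro ⟨j, l⟩ _
    rfl

/-- Contraction is a homotopy between multiplication by `x j` and zero. -/
lemma koszulContract_homotopy (x : ι → R) (j : ι) (f : Finset ι → M) :
    koszulContract j (koszulD x f) + koszulD x (koszulContract j f) = x j • f := by
  ext F
  simp only [Pi.add_apply, Pi.smul_apply, koszulContract, koszulD_apply]
  by_cases hj : j ∈ F
  · rw [if_pos hj, zero_add, Finset.sum_eq_single_of_mem j hj]
    · have h : koszulSign j F = koszulSign j (F.erase j) := by
        conv_lhs => rw [← Finset.insert_erase hj]
        exact koszulSign_insert_self (Finset.notMem_erase j F)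
      rw [if_neg (Finset.notMem_erase j F), Finset.insert_erase hj, ← h, smul_comm (x j),
        smul_smul, koszulSign_mul_self, one_smul]
    · intro l _ hlj
      rw [if_pos (Finset.mem_erase.2 ⟨hlj.symm, hj⟩), smul_zero, smul_zero]
  · rw [if_neg hj, Finset.sum_insert hj, Finset.erase_insert hj, koszulSign_insert_self hj,
      smul_add, smul_smul, koszulSign_mul_self, one_smul, add_assoc, Finset.smul_sum,
      ← Finset.sum_add_distrib, Finset.sum_eq_zero, add_zero]
    intro l hl
    have hne : j ≠ l := fun h => hj (h ▸ hl)
    rw [if_neg fun h => hj (Finset.mem_of_mem_erase h), Finset.erase_insert_of_ne hne,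
      smul_comm (x l) (koszulSign j (F.erase l)), smul_smul, smul_smul,
      koszulSign_anticomm hj hl, neg_smul, neg_add_cancel]

lemma exists_koszulD_eq_smul [Fintype ι] (x : ι → R) {r : R}
    (hr : r ∈ Ideal.span (Set.range x)) {i : ℕ} {z : Finset ι → M}
    (hz : ∀ F, F.card ≠ i → z F = 0) (hdz : koszulD x z = 0) :
    ∃ w : Finset ι → M, (∀ F, F.card + 1 ≠ i → w F = 0) ∧ koszulD x w = r • z := by
  obtain ⟨a, ha⟩ := (Submodule.mem_span_range_iff_exists_fun R).1 hr
  refine ⟨∑ j, a j • koszulContract j z, fun F hF => ?_, ?_⟩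
  · rw [Finset.sum_apply]
    refine Finset.sum_eq_zero fun j _ => ?_
    by_cases hj : j ∈ F
    · simp [koszulContract, hj]
    · simp [koszulContract, hj, hz (insert j F) (by rwa [Finset.card_insert_of_notMem hj])]
  · rw [map_sum, ← ha, Finset.sum_smul]
    refine Finset.sum_congr rfl fun j _ => ?_
    have h := koszulContract_homotopy x j z
    have h0 : koszulContract j (0 : Finset ι → M) = 0 := by
      ext F
      simp [koszulContract]
    rw [hdz, h0, zero_add] at h
    rw [map_smul, h, smul_assoc]

/-- Koszul cohomology vanishes below the length of a weakly regular sequence. -/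
theorem exists_koszulD_eq_of_isWeaklyRegular [Fintype ι] (x : ι → R) (rs : List R)
    (hrs : ∀ r ∈ rs, r ∈ Ideal.span (Set.range x))
    (hreg : RingTheory.Sequence.IsWeaklyRegular M rs) {i : ℕ} (hi : i < rs.length)
    {z : Finset ι → M} (hz : ∀ F, F.card ≠ i → z F = 0) (hdz : koszulD x z = 0) :
    ∃ u : Finset ι → M, (∀ F, F.card + 1 ≠ i → u F = 0) ∧ koszulD x u = z := by
  induction rs generalizing M i with
  | nil => simp at hi
  | cons r rs ih =>
    obtain ⟨hr, hreg'⟩ := (RingTheory.Sequence.isWeaklyRegular_cons_iff M r rs).1 hreg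
    obtain ⟨w, hw, hdw⟩ := exists_koszulD_eq_smul x (hrs r List.mem_cons_self) hz hdz
    have hcancel : ∀ u : Finset ι → M, r • koszulD x u = r • z → koszulD x u = z :=
      fun u hu => funext fun F => hr (congrFun hu F)
    rcases i with _ | i
    · refine ⟨0, fun F _ => rfl, hcancel 0 ?_⟩
      rw [← hdw, show w = 0 from funext fun F => hw F (by omega), map_zero, smul_zero]
    let q : M →ₗ[R] QuotSMulTop r M := Submodule.mkQ _
    have hq : Function.Surjective q := Submodule.mkQ_surjective _
    have hker : ∀ m, q m = 0 → ∃ m', r • m' = m := fun m hm => by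
      have := (Submodule.Quotient.mk_eq_zero _).1 hm
      obtain ⟨m', -, h⟩ := (Submodule.mem_smul_pointwise_iff_exists _ _ _).1 this
      exact ⟨m', h⟩
    have hqr : ∀ m, q (r • m) = 0 := fun m =>
      (Submodule.Quotient.mk_eq_zero _).2 (Submodule.smul_mem_pointwise_smul _ _ _ trivial)
    obtain ⟨v', hv', hdv'⟩ := ih (fun s hs => hrs s (List.mem_cons_of_mem _ hs)) hreg'
      (i := i) (by simpa using hi) (z := fun F => q (w F))
      (fun F hF => by rw [hw F (by omega), map_zero])
      (by
        ext F
        rw [koszulD_comp, hdw]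
        exact hqr _)
    have hlift : ∀ F, ∃ m, q m = v' F ∧ (F.card + 1 ≠ i → m = 0) := fun F => by
      by_cases hF : F.card + 1 = i
      · obtain ⟨m, hm⟩ := hq (v' F)
        exact ⟨m, hm, fun h => absurd hF h⟩
      · exact ⟨0, by rw [hv' F hF, map_zero], fun _ => rfl⟩
    choose v hqv hv using hlift
    have hdiv : ∀ F, ∃ m, r • m = w F - koszulD x v F ∧ (F.card + 1 ≠ i + 1 → m = 0) := by
      intro F
      by_cases hF : F.card = i
      · obtain ⟨m, hm⟩ := hker (w F - koszulD x v F) (by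
          rw [map_sub, ← koszulD_comp, funext hqv, hdv', sub_self])
        exact ⟨m, hm, fun h => absurd hF (by omega)⟩
      · refine ⟨0, ?_, fun _ => rfl⟩
        rw [hw F (by omega), koszulD_apply, Finset.sum_eq_zero, smul_zero, sub_zero]
        intro j hj
        rw [hv _ (by rwa [Finset.card_erase_add_one hj]), smul_zero, smul_zero]
    choose u hu hu0 using hdiv
    refine ⟨u, hu0, hcancel u ?_⟩
    have hw' : w = r • u + koszulD x v := by
      ext F
      rw [Pi.add_apply, Pi.smul_apply, hu, sub_add_cancel]
    rw [← hdw, hw', map_add, koszulD_koszulD, add_zero, map_smul]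

end Koszul

open Classical in
/-- If `D` induces maps `K^A → K^B → K^C` exact in the middle, then `#B ≤ #A + #C`. -/
lemma ncard_le_of_exact {K α : Type*} [Field K] [Fintype α] (D : (α → K) →ₗ[K] (α → K))
    (A B C : Set α)
    (h : ∀ c : α → K, (∀ a, a ∉ B → c a = 0) → (∀ a ∈ C, D c a = 0) →
      ∃ c' : α → K, (∀ a, a ∉ A → c' a = 0) ∧ ∀ a ∈ B, D c' a = c a) :
    B.ncard ≤ A.ncard + C.ncard := by
  let f : (A → K) →ₗ[K] (B → K) :=
    LinearMap.funLeft K K Subtype.val ∘ₗ D ∘ₗ Function.ExtendByZero.linearMap K Subtype.val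
  let g : (B → K) →ₗ[K] (C → K) :=
    LinearMap.funLeft K K Subtype.val ∘ₗ D ∘ₗ Function.ExtendByZero.linearMap K Subtype.val
  have hle : LinearMap.ker g ≤ LinearMap.range f := by
    intro c hc
    obtain ⟨c', hc', hD⟩ := h (Function.ExtendByZero.linearMap K Subtype.val c)
      (fun a ha => Function.extend_apply' (f := Subtype.val) _ _ a (fun ⟨b, hb⟩ => ha (hb ▸ b.2)))
      (fun a ha => congrFun (LinearMap.mem_ker.1 hc) ⟨a, ha⟩)
    refine ⟨fun a => c' a, funext fun b => ?_⟩
    have hext : Function.ExtendByZero.linearMap K Subtype.val (fun a : A => c' a) = c' := by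
      ext a
      by_cases ha : a ∈ A
      · exact Subtype.val_injective.extend_apply (fun a : A => c' a) 0 ⟨a, ha⟩
      · rw [hc' a ha]
        exact Function.extend_apply' (f := Subtype.val) (fun a : A => c' a) 0 a (fun ⟨b, hb⟩ => ha (hb ▸ b.2))
    change D (Function.ExtendByZero.linearMap K Subtype.val fun a : A => c' a) b = c b
    rw [hext, hD b b.2]
    exact Subtype.val_injective.extend_apply c 0 b
  have hrn := LinearMap.finrank_range_add_finrank_ker g
  have h₁ := (Submodule.finrank_mono hle).trans (LinearMap.finrank_range_le f)
  have h₂ := Submodule.finrank_le (LinearMap.range g)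
  simp only [Module.finrank_fintype_fun_eq_card, Fintype.card_eq_nat_card,
    Nat.card_coe_set_eq] at hrn h₁ h₂
  omega

section SquarefreeMonomials

variable {K : Type*} [Field K] {n : ℕ}

/-- The exponent vector of the squarefree monomial with support `F`. -/
noncomputable def sqfreeExp (F : Finset (Fin n)) : Fin n →₀ ℕ := Finsupp.indicator F fun _ _ => 1

lemma sqfreeExp_apply (F : Finset (Fin n)) (j : Fin n) :
    sqfreeExp F j = if j ∈ F then 1 else 0 := by
  simp [sqfreeExp, Finsupp.indicator_apply]

lemma support_sqfreeExp (F : Finset (Fin n)) : (sqfreeExp F).support = F := by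
  ext j
  simp [sqfreeExp_apply]

lemma mdeg_sqfreeExp (F : Finset (Fin n)) : mdeg (sqfreeExp F) = F.card := by
  simp +contextual [mdeg, Finsupp.sum, support_sqfreeExp, sqfreeExp_apply]

lemma IsSqfree.sqfreeExp_support {m : Fin n →₀ ℕ} (hm : IsSqfree m) :
    sqfreeExp m.support = m := by
  ext j
  have := hm j
  rw [sqfreeExp_apply]
  split_ifs with h
  · have := Finsupp.mem_support_iff.1 h
    omega
  · exact (Finsupp.notMem_support_iff.1 h).symm

lemma single_add_sqfreeExp_erase {F : Finset (Fin n)} {j : Fin n} (hj : j ∈ F) :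
    Finsupp.single j 1 + sqfreeExp (F.erase j) = sqfreeExp F := by
  ext l
  rw [Finsupp.add_apply, sqfreeExp_apply, sqfreeExp_apply, Finsupp.single_apply]
  by_cases h : j = l
  · subst h
    simp [hj]
  · simp [h, Ne.symm h]

/-- The supports of the squarefree monomials of degree `t` in `I \ J`. -/
def sqfreeSupports (I J : Ideal (MvPolynomial (Fin n) K)) (t : ℕ) : Set (Finset (Fin n)) :=
  {F | F.card = t ∧ monomial (sqfreeExp F) (1 : K) ∈ I ∧ monomial (sqfreeExp F) (1 : K) ∉ J}

lemma rho_eq_ncard_sqfreeSupports (I J : Ideal (MvPolynomial (Fin n) K)) (t : ℕ) :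
    rho K I J t = (sqfreeSupports I J t).ncard := by
  rw [rho, ← Set.ncard_image_of_injective (sqfreeSupports I J t) (f := sqfreeExp)
    fun F G h => by rw [← support_sqfreeExp F, h, support_sqfreeExp]]
  congr 1
  ext m
  constructor
  · rintro ⟨hm, hdeg, hI, hJ⟩
    rw [← hm.sqfreeExp_support] at hdeg hI hJ
    exact ⟨m.support, ⟨by rw [← hdeg, mdeg_sqfreeExp], hI, hJ⟩, hm.sqfreeExp_support⟩
  · rintro ⟨F, ⟨hF, hI, hJ⟩, rfl⟩
    refine ⟨fun j => ?_, by rw [mdeg_sqfreeExp, hF], hI, hJ⟩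
    rw [sqfreeExp_apply]
    split_ifs <;> simp

lemma GenSqfreeGe.monomial_mem {I : Ideal (MvPolynomial (Fin n) K)} {d : ℕ}
    (hI : GenSqfreeGe K d I) {f : MvPolynomial (Fin n) K} (hf : f ∈ I) {m : Fin n →₀ ℕ}
    (hm : coeff m f ≠ 0) : monomial m (1 : K) ∈ I := by
  obtain ⟨G, -, rfl⟩ := hI
  rw [mem_ideal_span_monomial_image] at hf ⊢
  intro m' hm'
  obtain rfl : m = m' := by
    by_contra h
    simp [coeff_monomial, h] at hm'
  exact hf m (mem_support_iff.2 hm)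

lemma GenSqfreeGe.le_mdeg {I : Ideal (MvPolynomial (Fin n) K)} {d : ℕ}
    (hI : GenSqfreeGe K d I) {m : Fin n →₀ ℕ} (hm : monomial m (1 : K) ∈ I) : d ≤ mdeg m := by
  obtain ⟨G, hG, rfl⟩ := hI
  rw [mem_ideal_span_monomial_image] at hm
  obtain ⟨g, hg, hle⟩ := hm m (by simp)
  refine (hG g hg).2.trans ?_
  simp only [mdeg]
  rw [Finsupp.sum_fintype _ _ fun _ => rfl, Finsupp.sum_fintype _ _ fun _ => rfl]
  exact Finset.sum_le_sum fun j _ => hle j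

lemma X_mul_monomial_sqfreeExp_erase {F : Finset (Fin n)} {j : Fin n} (hj : j ∈ F) (a : K) :
    X j * monomial (sqfreeExp (F.erase j)) a = monomial (sqfreeExp F) a := by
  rw [X, monomial_mul, one_mul, single_add_sqfreeExp_erase hj]

lemma koszulD_monomial (c : Finset (Fin n) → K) (F : Finset (Fin n)) :
    koszulD (X : Fin n → MvPolynomial (Fin n) K) (fun G => monomial (sqfreeExp G) (c G)) F =
      monomial (sqfreeExp F) (koszulD (fun _ => (1 : K)) c F) := by
  rw [koszulD_apply, koszulD_apply, map_sum]
  refine Finset.sum_congr rfl fun j hj => ?_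
  rw [smul_eq_mul, X_mul_monomial_sqfreeExp_erase hj, map_zsmul, one_smul]

lemma coeff_koszulD (U : Finset (Fin n) → MvPolynomial (Fin n) K) (F : Finset (Fin n)) :
    coeff (sqfreeExp F) (koszulD (X : Fin n → MvPolynomial (Fin n) K) U F) =
      koszulD (fun _ => (1 : K)) (fun G => coeff (sqfreeExp G) (U G)) F := by
  rw [koszulD_apply, koszulD_apply, coeff_sum]
  refine Finset.sum_congr rfl fun j hj => ?_
  rw [smul_eq_mul, coeff_smul, ← single_add_sqfreeExp_erase hj, coeff_X_mul, one_smul]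

lemma monomial_sqfreeExp_mem_of_erase {I : Ideal (MvPolynomial (Fin n) K)}
    {F : Finset (Fin n)} {j : Fin n}
    (h : monomial (sqfreeExp (F.erase j)) (1 : K) ∈ I) : monomial (sqfreeExp F) (1 : K) ∈ I := by
  by_cases hj : j ∈ F
  · rw [← X_mul_monomial_sqfreeExp_erase hj]
    exact I.mul_mem_left _ h
  · rwa [Finset.erase_eq_of_notMem hj] at h

lemma monomial_mem_of_one {I : Ideal (MvPolynomial (Fin n) K)} {m : Fin n →₀ ℕ}
    (h : monomial m (1 : K) ∈ I) (a : K) : monomial m a ∈ I := by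
  rw [← mul_one a, ← C_mul_monomial]
  exact I.mul_mem_left _ h

/-- The squarefree strand of the Koszul complex of `I/J` is exact in degrees below the length of
a weakly regular sequence. -/
lemma exists_koszulD_eq_on_sqfreeSupports {I J : Ideal (MvPolynomial (Fin n) K)} {d e : ℕ}
    (hI : GenSqfreeGe K d I) (hJ : GenSqfreeGe K e J)
    (rs : List (MvPolynomial (Fin n) K))
    (hrs : ∀ r ∈ rs, r ∈ Ideal.span (Set.range (X : Fin n → MvPolynomial (Fin n) K)))
    (hreg : RingTheory.Sequence.IsWeaklyRegular (quotMod I J) rs) {i : ℕ} (hi : i < rs.length)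
    {c : Finset (Fin n) → K} (hc : ∀ F, F ∉ sqfreeSupports I J i → c F = 0)
    (hdc : ∀ F ∈ sqfreeSupports I J (i + 1), koszulD (fun _ => (1 : K)) c F = 0) :
    ∃ c' : Finset (Fin n) → K,
      (∀ F, F ∉ {F | F.card + 1 = i ∧ F ∈ sqfreeSupports I J F.card} → c' F = 0) ∧
      ∀ F ∈ sqfreeSupports I J i, koszulD (fun _ => (1 : K)) c' F = c F := by
  classical
  have hZI : ∀ F, monomial (sqfreeExp F) (c F) ∈ I := fun F => by
    by_cases hF : F ∈ sqfreeSupports I J i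
    · exact monomial_mem_of_one hF.2.1 _
    · rw [hc F hF, map_zero]
      exact I.zero_mem
  let Z : Finset (Fin n) → I := fun F => ⟨monomial (sqfreeExp F) (c F), hZI F⟩
  let q : I →ₗ[MvPolynomial (Fin n) K] quotMod I J := Submodule.mkQ _
  have hq : Function.Surjective q := Submodule.mkQ_surjective _
  have hker : ∀ m, q m = 0 ↔ (m : MvPolynomial (Fin n) K) ∈ J := fun m =>
    Submodule.Quotient.mk_eq_zero _
  have hcoe : ∀ (U : Finset (Fin n) → I) (F : Finset (Fin n)),
      ((koszulD X U F : I) : MvPolynomial (Fin n) K) =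
        koszulD X (fun G => (U G : MvPolynomial (Fin n) K)) F :=
    fun U F => (koszulD_comp X I.subtype U F).symm
  obtain ⟨u, hu, hdu⟩ := exists_koszulD_eq_of_isWeaklyRegular X rs hrs hreg hi
    (z := fun F => q (Z F))
    (fun F hF => by
      rw [hker]
      change monomial (sqfreeExp F) (c F) ∈ J
      rw [hc F fun h => hF h.1, map_zero]
      exact J.zero_mem)
    (by
      ext F
      rw [koszulD_comp, Pi.zero_apply, hker, hcoe, koszulD_monomial]
      by_cases hFJ : monomial (sqfreeExp F) (1 : K) ∈ J
      · exact monomial_mem_of_one hFJ _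
      suffices h : koszulD (fun _ => (1 : K)) c F = 0 by
        rw [h, map_zero]
        exact J.zero_mem
      by_cases hF : F ∈ sqfreeSupports I J (i + 1)
      · exact hdc F hF
      rw [koszulD_apply]
      refine Finset.sum_eq_zero fun j hj => ?_
      rw [hc, smul_zero, smul_zero]
      intro h
      refine hF ⟨?_, monomial_sqfreeExp_mem_of_erase h.2.1, hFJ⟩
      rw [← h.1, Finset.card_erase_add_one hj])
  have hlift : ∀ F, ∃ m, q m = u F ∧ (F.card + 1 ≠ i → m = 0) := fun F => by
    by_cases hF : F.card + 1 = i
    · obtain ⟨m, hm⟩ := hq (u F)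
      exact ⟨m, hm, fun h => absurd hF h⟩
    · exact ⟨0, by rw [hu F hF, map_zero], fun _ => rfl⟩
  choose U hqU hU using hlift
  refine ⟨fun F => if monomial (sqfreeExp F) (1 : K) ∈ J then 0 else coeff (sqfreeExp F) (U F).1,
    fun F hF => ?_, fun F hF => ?_⟩
  · beta_reduce
    split_ifs with hFJ
    · rfl
    by_contra hne
    refine hF ⟨?_, rfl, hI.monomial_mem (U F).2 hne, hFJ⟩
    by_contra hcard
    exact hne (by rw [hU F hcard]; simp)
  · have hmem : koszulD (X : Fin n → MvPolynomial (Fin n) K) (fun G => (U G).1) F -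
        monomial (sqfreeExp F) (c F) ∈ J := by
      rw [← hcoe]
      change ((koszulD X U F - Z F : I) : MvPolynomial (Fin n) K) ∈ J
      rw [← hker, map_sub, ← koszulD_comp, funext hqU, hdu, sub_self]
    have hzero : coeff (sqfreeExp F)
        (koszulD (X : Fin n → MvPolynomial (Fin n) K) (fun G => (U G).1) F -
        monomial (sqfreeExp F) (c F)) = 0 := by
      by_contra hne
      exact hF.2.2 (hJ.monomial_mem hmem hne)
    rw [coeff_sub, coeff_koszulD, coeff_monomial, if_pos rfl, sub_eq_zero] at hzero
    rw [← hzero, koszulD_apply, koszulD_apply]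
    refine Finset.sum_congr rfl fun j _ => ?_
    rw [if_neg fun h => hF.2.2 (monomial_sqfreeExp_mem_of_erase h)]

/-- A module of depth at least `k > 0` has a weakly regular sequence of length at least `k` in the
ideal generated by the variables. -/
lemma exists_isWeaklyRegular_of_le_mdepth {M : Type*} [AddCommGroup M]
    [Module (MvPolynomial (Fin n) K) M] {k : ℕ} (hk : 0 < k) (h : k ≤ mdepth K n M) :
    ∃ rs : List (MvPolynomial (Fin n) K), k ≤ rs.length ∧
      (∀ r ∈ rs, r ∈ Ideal.span (Set.range (X : Fin n → MvPolynomial (Fin n) K))) ∧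
      RingTheory.Sequence.IsWeaklyRegular M rs := by
  obtain ⟨rs, hlen, hrs, hreg⟩ := Nat.sSup_mem
    (by
      by_contra he
      have h0 : mdepth K n M = 0 := by
        rw [mdepth]
        exact (congrArg sSup (Set.not_nonempty_iff_eq_empty.1 he)).trans csSup_empty
      omega) (by
      by_contra hb
      have h0 : mdepth K n M = 0 := Nat.sSup_of_not_bddAbove hb
      omega)
  exact ⟨rs, h.trans hlen.ge, hrs, hreg.toIsWeaklyRegular⟩

end SquarefreeMonomials

theorem rho_bounds {K : Type*} [Field K] {n d : ℕ}
    (I J : Ideal (MvPolynomial (Fin n) K)) (hJI : J < I)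
    (hI : GenSqfreeGe K d I) (hJ : GenSqfreeGe K (d + 1) J)
    (hdepth : d + 2 ≤ mdepth K n (quotMod I J)) :
    rho K I (⊥ : Ideal (MvPolynomial (Fin n) K)) d ≤ rho K I J (d + 1) ∧
    rho K I J (d + 1) ≤
      rho K I (⊥ : Ideal (MvPolynomial (Fin n) K)) d + rho K I J (d + 2) := by
  obtain ⟨rs, hlen, hrs, hreg⟩ := exists_isWeaklyRegular_of_le_mdepth (by omega) hdepth
  have hbound : ∀ i < d + 2, (sqfreeSupports I J i).ncard ≤
      {F | F.card + 1 = i ∧ F ∈ sqfreeSupports I J F.card}.ncard +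
        (sqfreeSupports I J (i + 1)).ncard := fun i hi =>
    ncard_le_of_exact (koszulD fun _ => (1 : K)) _ _ _ fun c hc hdc =>
      exists_koszulD_eq_on_sqfreeSupports hI hJ rs hrs hreg (hi.trans_le hlen) hc hdc
  have hbot : rho K I (⊥ : Ideal (MvPolynomial (Fin n) K)) d =
      (sqfreeSupports I J d).ncard := by
    rw [rho_eq_ncard_sqfreeSupports]
    congr 1
    ext F
    refine and_congr_right fun hF => and_congr_right fun _ => ⟨fun _ h => ?_, fun _ h => ?_⟩
    · have := hJ.le_mdeg h
      rw [mdeg_sqfreeExp] at this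
      omega
    · simp [monomial_eq_zero] at h
  have hempty : {F | F.card + 1 = d ∧ F ∈ sqfreeSupports I J F.card} = ∅ := by
    refine Set.eq_empty_of_forall_notMem ?_
    rintro F ⟨hF, hFI⟩
    have := hI.le_mdeg hFI.2.1
    rw [mdeg_sqfreeExp] at this
    omega
  have hdeg : {F | F.card + 1 = d + 1 ∧ F ∈ sqfreeSupports I J F.card} =
      sqfreeSupports I J d := by
    ext F
    constructor
    · rintro ⟨hF, hFI⟩
      rwa [Nat.succ_injective hF] at hFI
    · intro hF
      exact ⟨by rw [hF.1], by rwa [hF.1]⟩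
  have h₁ := hbound d (by omega)
  have h₂ := hbound (d + 1) (by omega)
  rw [hempty, Set.ncard_empty, zero_add] at h₁
  rw [hdeg] at h₂
  rw [hbot, rho_eq_ncard_sqfreeSupports, rho_eq_ncard_sqfreeSupports]
  exact ⟨h₁, h₂⟩
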